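/- (Lemma 1) Consider one step of stochastic-rounding SGD in ℝ^d: starting from a grid point w ∈ (Δℤ)^d, let g be a random stochastic gradient with 𝔼‖g‖₂² ≤ G², let α > 0 be the learning rate, and let r = Q_s(w − α g) − (w − α g) be the quantization error, where Q_s is applied coordinatewise with resolution Δ and the rounding randomness is independent of g. Then 𝔼‖r‖₂² ≤ Δ·α·𝔼‖g‖₁ ≤ √d·Δ·α·G. -/

import Mathlib

open MeasureTheory

/-- Integral over `[0,1]` of a two-valued step function jumping at `q`. -/
lemma integral_unitInterval_ite_le (a b : ℝ) {q : ℝ} (hq0 : 0 ≤ q) (hq1 : q ≤ 1) :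
    ∫ p in Set.Icc (0 : ℝ) 1, (if p ≤ q then a else b) = q * a + (1 - q) * b := by
  have h : (fun p : ℝ => if p ≤ q then a else b) =
      fun p => (Set.Iic q).indicator (fun _ => a - b) p + b := by
    funext p
    by_cases hp : p ≤ q <;> simp [Set.indicator, hp]
  have hset : Set.Icc (0 : ℝ) 1 ∩ Set.Iic q = Set.Icc 0 q := by
    ext p
    simp only [Set.mem_inter_iff, Set.mem_Icc, Set.mem_Iic]
    constructor
    · rintro ⟨⟨h0, _⟩, h1⟩
      exact ⟨h0, h1⟩
    · rintro ⟨h0, h1⟩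
      exact ⟨⟨h0, h1.trans hq1⟩, h1⟩
  rw [h, integral_add ((integrable_const _).indicator measurableSet_Iic) (integrable_const _),
    setIntegral_indicator measurableSet_Iic, hset]
  simp [hq0]
  ring

/-- The Bernoulli variance with parameter `Int.fract y` is at most `|y|`. -/
lemma fract_mul_one_sub_fract_le_abs (y : ℝ) : Int.fract y * (1 - Int.fract y) ≤ |y| := by
  have h0 := Int.fract_nonneg y
  have h1 := (Int.fract_lt_one y).le
  rcases le_or_gt 0 y with hy | hy
  · rw [abs_of_nonneg hy]
    have hf : (0 : ℝ) ≤ ⌊y⌋ := by exact_mod_cast Int.floor_nonneg.2 hy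
    have := Int.self_sub_floor y
    nlinarith
  · rw [abs_of_neg hy]
    have hf : (⌊y⌋ : ℝ) ≤ -1 := by
      have : ⌊y⌋ < 0 := Int.floor_lt.2 (by simpa using hy)
      exact_mod_cast (show ⌊y⌋ ≤ -1 by omega)
    have := Int.self_sub_floor y
    nlinarith

/-- Squared stochastic rounding error at resolution `Δ`, as a two-valued step function. -/
lemma sq_stochasticRound_sub {Δ : ℝ} (hΔ : Δ ≠ 0) (v p : ℝ) :
    ((if p ≤ v / Δ - ⌊v / Δ⌋ then Δ * (⌊v / Δ⌋ + 1) else Δ * ⌊v / Δ⌋) - v) ^ 2 =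
      if p ≤ Int.fract (v / Δ) then Δ ^ 2 * (1 - Int.fract (v / Δ)) ^ 2
      else Δ ^ 2 * Int.fract (v / Δ) ^ 2 := by
  have hv : v = Δ * (⌊v / Δ⌋ + Int.fract (v / Δ)) := by
    rw [Int.floor_add_fract, mul_div_cancel₀ v hΔ]
  rw [Int.self_sub_floor]
  generalize Int.fract (v / Δ) = q at *
  generalize (⌊v / Δ⌋ : ℝ) = n at *
  subst hv
  split_ifs <;> ring

/-- Cauchy–Schwarz for the expected `ℓ¹` norm of a random vector. -/
lemma integral_sum_abs_le_sqrt_mul {Ω : Type*} [MeasurableSpace Ω] {μ : Measure Ω}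
    [IsProbabilityMeasure μ] {d : ℕ} {g : Ω → Fin d → ℝ} {G : ℝ} (hG : 0 < G)
    (hint : Integrable (fun ω => ∑ k, |g ω k|) μ)
    (hsq : Integrable (fun ω => ∑ k, (g ω k) ^ 2) μ)
    (hG2 : ∫ ω, ∑ k, (g ω k) ^ 2 ∂μ ≤ G ^ 2) :
    ∫ ω, ∑ k, |g ω k| ∂μ ≤ √d * G := by
  rcases Nat.eq_zero_or_pos d with rfl | hd
  · simp
  have hs : 0 < √(d : ℝ) := Real.sqrt_pos.2 (by exact_mod_cast hd)
  have hss : √(d : ℝ) * √d = d := Real.mul_self_sqrt (Nat.cast_nonneg d)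
  have hpt (ω : Ω) : 2 * G * √d * ∑ k, |g ω k| ≤ d * ∑ k, (g ω k) ^ 2 + d * G ^ 2 := by
    have : ∑ k, 2 * G * √d * |g ω k| ≤ ∑ k, (d * (g ω k) ^ 2 + G ^ 2) := by
      refine Finset.sum_le_sum fun k _ => ?_
      calc 2 * G * √d * |g ω k| ≤ √d * √d * |g ω k| ^ 2 + G ^ 2 := by
            nlinarith [sq_nonneg (√d * |g ω k| - G)]
        _ = _ := by rw [hss, sq_abs]
    simpa [Finset.mul_sum, Finset.sum_add_distrib] using this
  have hI := integral_mono (hint.const_mul (2 * G * √d))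
    ((hsq.const_mul (d : ℝ)).add (integrable_const (d * G ^ 2))) hpt
  rw [integral_const_mul, integral_add' (hsq.const_mul (d : ℝ)) (integrable_const _),
    integral_const_mul] at hI
  simp only [integral_const, probReal_univ, one_smul] at hI
  have hle : (2 * G * √d) * ∫ ω, ∑ k, |g ω k| ∂μ ≤ (2 * G * √d) * (√d * G) := by
    have hd0 : (0 : ℝ) ≤ d := Nat.cast_nonneg d
    have := mul_le_mul_of_nonneg_left hG2 hd0
    calc _ ≤ _ := hI
      _ ≤ 2 * G ^ 2 * d := by linarith
      _ = 2 * G ^ 2 * (√d * √d) := by rw [hss]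
      _ = _ := by ring
  exact le_of_mul_le_mul_left hle (by positivity)

/-- **Lemma 1: bound on the stochastic rounding error of one SR-SGD step.**
Starting from a grid point `w ∈ (Δℤ)^d`, take a stochastic gradient `g` with
`𝔼‖g‖₂² ≤ G²`, a learning rate `α > 0`, and round `w − α g` coordinatewise with the
stochastic rounding operator `Q_s` (resolution `Δ`, driven by `d` independent uniform
random variables, independent of `g`).  Then the quantization error
`r = Q_s(w − α g) − (w − α g)` satisfies `𝔼‖r‖₂² ≤ Δ·α·𝔼‖g‖₁ ≤ √d·Δ·α·G`. -/
theorem sr_quantization_error_bound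
    {Ω : Type*} [MeasurableSpace Ω] (μ : Measure Ω) [IsProbabilityMeasure μ]
    (d : ℕ) (Δ α G : ℝ) (hΔ : 0 < Δ) (hα : 0 < α) (hG : 0 < G)
    (w : Fin d → ℝ) (hw : ∀ k, ∃ m : ℤ, w k = Δ * m)
    (g : Ω → Fin d → ℝ) (hgmeas : Measurable g)
    (hgsqint : Integrable (fun ω => ∑ k, (g ω k) ^ 2) μ)
    (hG2 : ∫ ω, ∑ k, (g ω k) ^ 2 ∂μ ≤ G ^ 2)
    (Qs : ℝ → ℝ → ℝ)
    (hQs : ∀ v p : ℝ, Qs v p =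
      if p ≤ v / Δ - ⌊v / Δ⌋ then Δ * (⌊v / Δ⌋ + 1) else Δ * ⌊v / Δ⌋)
    -- `P` is the law of the `d` independent uniform rounding variables on `[0,1]^d`
    (P : Measure (Fin d → ℝ))
    (hP : P = Measure.pi fun _ : Fin d => volume.restrict (Set.Icc (0:ℝ) 1)) :
    (∫ ω, ∫ p,
        (∑ k, (Qs (w k - α * g ω k) (p k) - (w k - α * g ω k)) ^ 2) ∂P ∂μ)
      ≤ Δ * α * ∫ ω, ∑ k, |g ω k| ∂μ ∧
    Δ * α * ∫ ω, ∑ k, |g ω k| ∂μ ≤ Real.sqrt d * Δ * α * G := by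
  have hint : Integrable (fun ω => ∑ k, |g ω k|) μ := by
    refine (hgsqint.add (integrable_const (d : ℝ))).mono'
      (Finset.measurable_sum _ fun k _ =>
        ((measurable_pi_apply k).comp hgmeas).abs).aestronglyMeasurable
      (Filter.Eventually.of_forall fun ω => ?_)
    rw [Real.norm_of_nonneg (Finset.sum_nonneg fun k _ => abs_nonneg _)]
    have : ∑ k, |g ω k| ≤ ∑ k, ((g ω k) ^ 2 + 1) := by
      refine Finset.sum_le_sum fun k _ => ?_
      rw [← sq_abs (g ω k)]
      nlinarith [sq_nonneg (|g ω k| - 1)]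
    simpa [Finset.sum_add_distrib] using this
  have : IsProbabilityMeasure (volume.restrict (Set.Icc (0 : ℝ) 1)) := ⟨by simp⟩
  refine ⟨?_, ?_⟩
  · rw [← integral_const_mul]
    refine integral_mono_of_nonneg
      (Filter.Eventually.of_forall fun ω => integral_nonneg fun p =>
        Finset.sum_nonneg fun k _ => sq_nonneg _)
      (hint.const_mul _) (Filter.Eventually.of_forall fun ω => ?_)
    have hmp (k : Fin d) : MeasurePreserving (Function.eval k) P
        (volume.restrict (Set.Icc (0 : ℝ) 1)) :=
      hP ▸ measurePreserving_eval (fun _ : Fin d => volume.restrict (Set.Icc (0 : ℝ) 1)) k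
    have hstep (a b q : ℝ) : Measurable fun p : ℝ => if p ≤ q then a else b :=
      Measurable.ite measurableSet_Iic measurable_const measurable_const
    have hstep_int (a b q : ℝ) : Integrable (fun p : ℝ => if p ≤ q then a else b)
        (volume.restrict (Set.Icc (0 : ℝ) 1)) := by
      refine Integrable.of_bound (hstep a b q).aestronglyMeasurable (max |a| |b|)
        (Filter.Eventually.of_forall fun p => ?_)
      split_ifs <;> simp
    simp only [hQs, sq_stochasticRound_sub hΔ.ne']
    rw [integral_finsetSum, Finset.mul_sum]
    rotate_left
    · exact fun k _ => (hmp k).integrable_comp_of_integrable (hstep_int _ _ _)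
    refine Finset.sum_le_sum fun k _ => ?_
    obtain ⟨m, hm⟩ := hw k
    have hfract : Int.fract ((w k - α * g ω k) / Δ) = Int.fract (-(α * g ω k / Δ)) := by
      rw [hm, sub_div, mul_div_cancel_left₀ _ hΔ.ne', sub_eq_add_neg, Int.fract_intCast_add]
    rw [hfract]
    set y := -(α * g ω k / Δ) with hy
    have habs : |y| = α * |g ω k| / Δ := by
      rw [hy, abs_neg, abs_div, abs_mul, abs_of_pos hα, abs_of_pos hΔ]
    have hcomp := (hmp k).map_eq ▸ integral_map (hmp k).measurable.aemeasurable
      (hstep (Δ ^ 2 * (1 - Int.fract y) ^ 2) (Δ ^ 2 * Int.fract y ^ 2)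
        (Int.fract y)).aestronglyMeasurable
    calc _ = ∫ p in Set.Icc (0 : ℝ) 1, (if p ≤ Int.fract y then
            Δ ^ 2 * (1 - Int.fract y) ^ 2 else Δ ^ 2 * Int.fract y ^ 2) := hcomp.symm
      _ = Δ ^ 2 * (Int.fract y * (1 - Int.fract y)) := by
          rw [integral_unitInterval_ite_le _ _ (Int.fract_nonneg y) (Int.fract_lt_one y).le]
          ring
      _ ≤ Δ ^ 2 * |y| := by
          gcongr
          exact fract_mul_one_sub_fract_le_abs y
      _ = Δ * α * |g ω k| := by
          rw [habs]
          field_simp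
  · calc _ ≤ Δ * α * (√d * G) := by
          gcongr
          exact integral_sum_abs_le_sqrt_mul hG hint hgsqint hG2
      _ = _ := by ring
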